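/- Let K be an abstract simplicial complex on [m] and J = (j_1,…,j_m) an m-tuple of positive integers. For k ∈ [m] set k̃ = k + Σ_{r<k}(j_r−1) and B̃_k = {k̃+1, k̃+2, …, k̃+j_k−1} ⊆ [d(J)]. Then the assignment ṽ^k ↦ u^{k̃}·Π_{r∈B̃_k} u^r and ũ^k ↦ t^{k̃}·Π_{r∈B̃_k} u^r (products in increasing order of index) extends to an injective homomorphism of differential graded algebras R*_K(J) → R*_{K(J)}, and this homomorphism induces an isomorphism on cohomology. -/

import Mathlib

set_option synthInstance.maxHeartbeats 1000000
set_option maxHeartbeats 1000000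

structure ASC (m : ℕ) where
  faces : Set (Finset (Fin m))
  empty_mem : ∅ ∈ faces
  down_closed : ∀ {σ τ : Finset (Fin m)}, σ ∈ faces → τ ⊆ σ → τ ∈ faces

variable {n : ℕ}

/-- index of the square-free monomials `ṽ^σ ũ^τ`. -/
def MonIdx (F : Set (Finset (Fin n))) : Type :=
  {p : Finset (Fin n) × Finset (Fin n) // p.1 ∈ F ∧ Disjoint p.1 p.2}

/-- the free `ℤ`-module on the square-free monomials: the underlying module of `R*_K(J)`. -/
abbrev RMod (F : Set (Finset (Fin n))) : Type := MonIdx F →₀ ℤ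

/-- degree of `ṽ^σ ũ^τ`. -/
def degMon (J : Fin n → ℕ) {F : Set (Finset (Fin n))} (b : MonIdx F) : ℕ :=
  ∑ i ∈ b.1.1, J i + ∑ i ∈ b.1.2, (J i - 1)

open Classical in
/-- the differential of `R*_K(J)`. -/
noncomputable def dR (F : Set (Finset (Fin n))) (J : Fin n → ℕ) :
    RMod F →ₗ[ℤ] RMod F :=
  Finsupp.lift (RMod F) ℤ (MonIdx F) fun b =>
    ∑ i ∈ b.1.2,
      if h : insert i b.1.1 ∈ F then
        ((-1 : ℤ) ^ (∑ k ∈ b.1.1.filter (fun k => k < i), J k +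
            ∑ k ∈ b.1.2.filter (fun k => k < i), (J k - 1))) •
          Finsupp.single (⟨(insert i b.1.1, b.1.2.erase i),
            ⟨h, by
              refine Finset.disjoint_left.2 fun a ha hb => ?_
              rcases Finset.mem_insert.1 ha with h' | h'
              · exact (Finset.mem_erase.1 hb).1 h'
              · exact (Finset.disjoint_left.1 b.2.2 h') (Finset.mem_of_mem_erase hb)⟩⟩ :
              MonIdx F) (1 : ℤ)
      else 0

open Classical in
/-- product of two square-free monomials. -/
noncomputable def mulMon (F : Set (Finset (Fin n))) (J : Fin n → ℕ)
    (a b : MonIdx F) : RMod F :=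
  if h : (a.1.1 ∪ b.1.1) ∈ F ∧ Disjoint a.1.1 b.1.1 ∧ Disjoint a.1.2 b.1.1 ∧
      (∀ i ∈ (a.1.1 ∩ b.1.2) ∪ (a.1.2 ∩ b.1.2), J i = 1) then
    ((-1 : ℤ) ^ (∑ i ∈ a.1.1 ∪ a.1.2, ∑ k ∈ (b.1.1 ∪ b.1.2).filter (fun k => k < i),
        (if i ∈ a.1.1 then J i else J i - 1) * (if k ∈ b.1.1 then J k else J k - 1))) •
      Finsupp.single (⟨(a.1.1 ∪ b.1.1, (a.1.2 ∪ b.1.2) \ (a.1.1 ∪ b.1.1)),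
        ⟨h.1, Finset.disjoint_sdiff⟩⟩ : MonIdx F) (1 : ℤ)
  else 0

/-- the product on the model of `R*_K(J)`. -/
noncomputable def mulR (F : Set (Finset (Fin n))) (J : Fin n → ℕ) :
    RMod F →ₗ[ℤ] RMod F →ₗ[ℤ] RMod F :=
  Finsupp.lift (RMod F →ₗ[ℤ] RMod F) ℤ (MonIdx F) fun a =>
    Finsupp.lift (RMod F) ℤ (MonIdx F) fun b => mulMon F J a b

open Classical in
/-- the unit monomial -/
noncomputable def oneR (F : Set (Finset (Fin n))) : RMod F :=
  if h : ∅ ∈ F then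
    Finsupp.single (⟨(∅, ∅), ⟨h, by simp⟩⟩ : MonIdx F) (1 : ℤ)
  else 0

open Classical in
/-- the generator `ṽ^k` of the model of `R*_K(J)` (zero if `{k} ∉ K`). -/
noncomputable def genV (F : Set (Finset (Fin n))) (k : Fin n) : RMod F :=
  if h : ({k} : Finset (Fin n)) ∈ F then
    Finsupp.single (⟨({k}, ∅), ⟨h, by simp⟩⟩ : MonIdx F) (1 : ℤ)
  else 0

open Classical in
/-- the generator `ũ^k` of the model of `R*_K(J)`. -/
noncomputable def genU (F : Set (Finset (Fin n))) (k : Fin n) : RMod F :=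
  if h : (∅ : Finset (Fin n)) ∈ F then
    Finsupp.single (⟨(∅, {k}), ⟨h, by simp⟩⟩ : MonIdx F) (1 : ℤ)
  else 0

open Classical in
noncomputable def partSub {ι α : Type*} (f : ι → α) (a : α) : Submodule ℤ (ι →₀ ℤ) where
  carrier := {x | ∀ b ∈ x.support, f b = a}
  add_mem' := by
    intro x y hx hy b hb
    rcases Finset.mem_union.1 (Finsupp.support_add hb) with h | h
    · exact hx b h
    · exact hy b h
  zero_mem' := by intro b hb; simp at hb
  smul_mem' := by
    intro c x hx b hb
    exact hx b (Finsupp.support_smul hb)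

/-- `d(J) = ∑ j_i` -/
def dJ {m : ℕ} (J : Fin m → ℕ) : ℕ := ∑ i, J i

/-- the block `B_i ⊆ [d(J)]`. -/
def Bblk {m : ℕ} (J : Fin m → ℕ) (i : Fin m) : Finset (Fin (dJ J)) :=
  Finset.univ.filter fun r =>
    (∑ k ∈ Finset.Iio i, J k) ≤ (r : ℕ) ∧ (r : ℕ) < ∑ k ∈ Finset.Iic i, J k

def IsMissingFace {m : ℕ} (K : ASC m) (τ : Finset (Fin m)) : Prop :=
  τ ∉ K.faces ∧ ∀ s ⊂ τ, s ∈ K.faces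

/-- the faces of `K(J)`. -/
def KJfaces {m : ℕ} (K : ASC m) (J : Fin m → ℕ) : Set (Finset (Fin (dJ J))) :=
  {σ | ∀ τ : Finset (Fin m), IsMissingFace K τ → ¬ (τ.biUnion (Bblk J) ⊆ σ)}

section

variable {m : ℕ} (K : ASC m) (J : Fin m → ℕ)

/-- `k̃ - 1`, i.e. the position `∑_{r<k} j_r` of the first vertex of the block `B_k`
(0-indexed); `k̃ = k + ∑_{r<k}(j_r - 1)` in the 1-indexed notation of the paper. -/
def startJ (k : Fin m) : ℕ := ∑ r ∈ Finset.Iio k, J r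

/-- `B̃_k = B_k ∖ {k̃}` -/
def Btil (k : Fin m) : Finset (Fin (dJ J)) :=
  (Bblk J k).filter fun r => startJ J k < (r : ℕ)

/-- the product `∏_{r ∈ s} u^r` (in increasing order) in the model of `R*_{K(J)}`. -/
noncomputable def prodV (s : Finset (Fin (dJ J))) : RMod (KJfaces K J) :=
  ((s.sort (· ≤ ·)).map (genV (KJfaces K J))).foldr
    (fun a b => mulR (KJfaces K J) (fun _ => 1) a b) (oneR (KJfaces K J))

open Classical in
/-- `u^{k̃}` -/
noncomputable def uKtil (k : Fin m) : RMod (KJfaces K J) :=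
  if h : startJ J k < dJ J then genV (KJfaces K J) ⟨startJ J k, h⟩ else 0

open Classical in
/-- `t^{k̃}` -/
noncomputable def tKtil (k : Fin m) : RMod (KJfaces K J) :=
  if h : startJ J k < dJ J then genU (KJfaces K J) ⟨startJ J k, h⟩ else 0

/-- the image `u^{k̃} ∏_{r∈B̃_k} u^r` of `ṽ^k` -/
noncomputable def vImg (k : Fin m) : RMod (KJfaces K J) :=
  mulR (KJfaces K J) (fun _ => 1) (uKtil K J k) (prodV K J (Btil J k))

/-- the image `t^{k̃} ∏_{r∈B̃_k} u^r` of `ũ^k` -/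
noncomputable def uImg (k : Fin m) : RMod (KJfaces K J) :=
  mulR (KJfaces K J) (fun _ => 1) (tKtil K J k) (prodV K J (Btil J k))

open Classical in
/-- total version of the square-free monomials -/
noncomputable def mon {N : ℕ} (F : Set (Finset (Fin N))) (V U : Finset (Fin N)) : RMod F :=
  if h : V ∈ F ∧ Disjoint V U then
    Finsupp.single (⟨(V, U), h⟩ : MonIdx F) (1 : ℤ) else 0

theorem mon_of {N : ℕ} {F : Set (Finset (Fin N))} (b : MonIdx F) :
    mon F b.1.1 b.1.2 = Finsupp.single b 1 := by
  unfold mon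
  rw [dif_pos b.2]
  rfl

theorem mon_not {N : ℕ} {F : Set (Finset (Fin N))} {V U : Finset (Fin N)} (h : V ∉ F) :
    mon F V U = 0 := by
  unfold mon
  rw [dif_neg (fun h' => h h'.1)]

theorem lift_mon {N : ℕ} {F : Set (Finset (Fin N))} {M : Type*} [AddCommGroup M]
    (f : MonIdx F → M) {V U : Finset (Fin N)} (h : V ∈ F) (hd : Disjoint V U) :
    Finsupp.lift M ℤ (MonIdx F) f (mon F V U) = f ⟨(V, U), h, hd⟩ := by
  have h1 : ∀ b : MonIdx F, Finsupp.lift M ℤ (MonIdx F) f (mon F b.1.1 b.1.2) = f b := by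
    intro b
    rw [mon_of, Finsupp.lift_apply]
    rw [Finsupp.sum_single_index (by simp), one_smul]
  exact h1 ⟨(V, U), h, hd⟩

def DownC {N : ℕ} (F : Set (Finset (Fin N))) : Prop :=
  ∀ σ τ : Finset (Fin N), σ ∈ F → τ ⊆ σ → τ ∈ F

theorem lin_ext {N : ℕ} {F : Set (Finset (Fin N))} {M : Type*} [AddCommGroup M]
    (f g : RMod F →ₗ[ℤ] M)
    (h : ∀ V U, V ∈ F → Disjoint V U → f (mon F V U) = g (mon F V U)) : f = g := by
  apply Finsupp.lhom_ext'
  intro b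
  apply LinearMap.ext_ring
  have := h b.1.1 b.1.2 b.2.1 b.2.2
  rw [mon_of] at this
  simpa using this

theorem oneR_eq {N : ℕ} (F : Set (Finset (Fin N))) : oneR F = mon F ∅ ∅ := by
  unfold oneR
  split_ifs with h
  · exact (mon_of _).symm
  · exact (mon_not h).symm

theorem genV_eq {N : ℕ} (F : Set (Finset (Fin N))) (k : Fin N) : genV F k = mon F {k} ∅ := by
  unfold genV
  split_ifs with h
  · exact (mon_of _).symm
  · exact (mon_not h).symm

theorem genU_eq {N : ℕ} (F : Set (Finset (Fin N))) (k : Fin N) : genU F k = mon F ∅ {k} := by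
  unfold genU
  split_ifs with h
  · exact (mon_of _).symm
  · exact (mon_not h).symm

theorem dR_mon {N : ℕ} {F : Set (Finset (Fin N))} (hF : DownC F) (J : Fin N → ℕ)
    {V U : Finset (Fin N)} (hd : Disjoint V U) :
    dR F J (mon F V U) = ∑ i ∈ U, ((-1 : ℤ) ^ (∑ k ∈ V.filter (fun k => k < i), J k +
            ∑ k ∈ U.filter (fun k => k < i), (J k - 1))) • mon F (insert i V) (U.erase i) := by
  by_cases h : V ∈ F
  · unfold dR
    rw [lift_mon _ h hd]
    refine Finset.sum_congr rfl fun i hi => ?_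
    have hd' : Disjoint (insert i V) (U.erase i) := by
      refine Finset.disjoint_left.2 fun a ha hb => ?_
      rcases Finset.mem_insert.1 ha with h' | h'
      · exact (Finset.mem_erase.1 hb).1 h'
      · exact (Finset.disjoint_left.1 hd h') (Finset.mem_of_mem_erase hb)
    by_cases h1 : insert i V ∈ F
    · refine (dif_pos h1).trans ?_
      congr 1
      exact (mon_of (⟨(insert i V, U.erase i), h1, hd'⟩ : MonIdx F)).symm
    · rw [mon_not h1, smul_zero]
      exact dif_neg h1
  · rw [mon_not h, map_zero]
    symm
    refine Finset.sum_eq_zero fun i hi => ?_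
    rw [mon_not, smul_zero]
    exact fun h' => h (hF _ _ h' (Finset.subset_insert _ _))

open Classical in
theorem mulR_mon {N : ℕ} {F : Set (Finset (Fin N))} (hF : DownC F) (J : Fin N → ℕ)
    {V U V' U' : Finset (Fin N)} (hd : Disjoint V U) (hd' : Disjoint V' U') :
    mulR F J (mon F V U) (mon F V' U') =
      if Disjoint V V' ∧ Disjoint U V' ∧ (∀ i ∈ (V ∩ U') ∪ (U ∩ U'), J i = 1) then
      ((-1 : ℤ) ^ (∑ i ∈ V ∪ U, ∑ k ∈ (V' ∪ U').filter (fun k => k < i),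
        (if i ∈ V then J i else J i - 1) * (if k ∈ V' then J k else J k - 1))) •
        mon F (V ∪ V') ((U ∪ U') \ (V ∪ V')) else 0 := by
  by_cases h : V ∈ F
  · by_cases h' : V' ∈ F
    · unfold mulR
      rw [lift_mon _ h hd, lift_mon _ h' hd']
      unfold mulMon
      by_cases h1 : V ∪ V' ∈ F
      · by_cases h2 : Disjoint V V' ∧ Disjoint U V' ∧ (∀ i ∈ (V ∩ U') ∪ (U ∩ U'), J i = 1)
        · rw [if_pos h2]
          refine (dif_pos ⟨h1, h2⟩).trans ?_
          congr 1
          exact (mon_of (⟨(V ∪ V', (U ∪ U') \ (V ∪ V')), h1, Finset.disjoint_sdiff⟩ :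
            MonIdx F)).symm
        · rw [if_neg h2]
          exact dif_neg (fun hh => h2 hh.2)
      · rw [mon_not h1, smul_zero, ite_self]
        exact dif_neg (fun hh => h1 hh.1)
    · rw [mon_not h', mon_not (V := V ∪ V')
        (fun hh => h' (hF _ _ hh Finset.subset_union_right))]
      simp
  · rw [mon_not h, mon_not (V := V ∪ V')
        (fun hh => h (hF _ _ hh Finset.subset_union_left))]
    simp

/-- sign -/
def sg {N : ℕ} (V : Finset (Fin N)) (i : Fin N) : ℤ := (-1) ^ (V.filter (fun k => k < i)).card

theorem sg_sq {N : ℕ} (V : Finset (Fin N)) (i : Fin N) : sg V i * sg V i = 1 := by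
  unfold sg
  rw [← mul_pow]; simp

theorem sg_insert {N : ℕ} {V : Finset (Fin N)} {i : Fin N} (h : i ∉ V) (j : Fin N) :
    sg (insert i V) j = (if i < j then -1 else 1) * sg V j := by
  unfold sg
  rw [Finset.filter_insert]
  split_ifs with h1
  · rw [Finset.card_insert_of_notMem (by simp [h]), pow_succ]; ring
  · simp

theorem dR1_mon {N : ℕ} {F : Set (Finset (Fin N))} (hF : DownC F)
    {V U : Finset (Fin N)} (hd : Disjoint V U) :
    dR F (fun _ => 1) (mon F V U) =
      ∑ i ∈ U, sg V i • mon F (insert i V) (U.erase i) := by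
  rw [dR_mon hF _ hd]
  refine Finset.sum_congr rfl fun i hi => ?_
  simp [sg]

theorem disj_ins {N : ℕ} {V U : Finset (Fin N)} (hd : Disjoint V U) (i : Fin N) :
    Disjoint (insert i V) (U.erase i) := by
  refine Finset.disjoint_left.2 fun a ha hb => ?_
  rcases Finset.mem_insert.1 ha with h' | h'
  · exact (Finset.mem_erase.1 hb).1 h'
  · exact (Finset.disjoint_left.1 hd h') (Finset.mem_of_mem_erase hb)

theorem dd {N : ℕ} {F : Set (Finset (Fin N))} (hF : DownC F) (x : RMod F) :
    dR F (fun _ => 1) (dR F (fun _ => 1) x) = 0 := by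
  suffices h : (dR F (fun _ => 1)).comp (dR F (fun _ => 1)) = 0 from
    LinearMap.congr_fun h x
  apply lin_ext
  intro V U hV hd
  simp only [LinearMap.comp_apply, LinearMap.zero_apply]
  rw [dR1_mon hF hd, map_sum]
  have key : ∀ i ∈ U, dR F (fun _ => 1) (sg V i • mon F (insert i V) (U.erase i)) =
      ∑ j ∈ U, if i = j then 0 else (sg V i * sg (insert i V) j) •
        mon F (insert j (insert i V)) ((U.erase i).erase j) := by
    intro i hi
    rw [map_smul, dR1_mon hF (disj_ins hd i), Finset.smul_sum,
      ← Finset.sum_erase_add _ _ hi]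
    rw [if_pos rfl, add_zero]
    refine Finset.sum_congr rfl fun j hj => ?_
    rw [if_neg (fun h => (Finset.mem_erase.1 hj).1 h.symm), smul_smul]
  rw [Finset.sum_congr rfl key]
  set S := ∑ i ∈ U, ∑ j ∈ U, (if i = j then (0 : RMod F) else (sg V i * sg (insert i V) j) •
        mon F (insert j (insert i V)) ((U.erase i).erase j)) with hS
  have h2 : S = -S := by
    conv_lhs => rw [hS, Finset.sum_comm]
    rw [hS, ← Finset.sum_neg_distrib]
    refine Finset.sum_congr rfl fun i hi => ?_
    rw [← Finset.sum_neg_distrib]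
    refine Finset.sum_congr rfl fun j hj => ?_
    by_cases hij : i = j
    · simp [hij]
    · rw [if_neg hij, if_neg (Ne.symm hij), Finset.insert_comm, Finset.erase_right_comm,
        ← neg_smul]
      congr 1
      have hi' : i ∉ V := fun h => Finset.disjoint_left.1 hd h hi
      have hj' : j ∉ V := fun h => Finset.disjoint_left.1 hd h hj
      rw [sg_insert hi', sg_insert hj']
      rcases lt_or_gt_of_ne hij with h | h
      · rw [if_pos h, if_neg (not_lt.2 h.le)]; ring
      · rw [if_pos h, if_neg (not_lt.2 h.le)]; ring
  have h3 : (2 : ℤ) • S = 0 := by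
    rw [two_smul]; nth_rewrite 1 [h2]; simp
  exact (smul_eq_zero.1 h3).resolve_left (by norm_num)

/-- abstract block data -/
structure BD (m N : ℕ) (J : Fin m → ℕ) where
  blk : Fin N → Fin m
  st : Fin m → Fin N
  blk_st : ∀ i, blk (st i) = i
  mono : ∀ r s, blk r < blk s → r < s
  st_le : ∀ r, st (blk r) ≤ r
  card : ∀ i, (Finset.univ.filter (fun r => blk r = i)).card = J i

namespace BD

variable {m N : ℕ} {J : Fin m → ℕ} (B : BD m N J)

/-- indices of blocks contained in `V` -/
def full (V : Finset (Fin N)) : Finset (Fin m) :=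
  Finset.univ.filter (fun i => ∀ r, B.blk r = i → r ∈ V)

/-- V-part of the image -/
def vv (σ τ : Finset (Fin m)) : Finset (Fin N) :=
  Finset.univ.filter (fun r => B.blk r ∈ σ ∨ (B.blk r ∈ τ ∧ r ≠ B.st (B.blk r)))

/-- U-part of the image -/
def uu (τ : Finset (Fin m)) : Finset (Fin N) :=
  Finset.univ.filter (fun r => B.blk r ∈ τ ∧ r = B.st (B.blk r))

theorem mem_full {V i} : i ∈ B.full V ↔ ∀ r, B.blk r = i → r ∈ V := by simp [full]

theorem mem_vv {σ τ r} : r ∈ B.vv σ τ ↔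
    (B.blk r ∈ σ ∨ (B.blk r ∈ τ ∧ r ≠ B.st (B.blk r))) := by simp [vv]

theorem mem_uu {τ r} : r ∈ B.uu τ ↔ (B.blk r ∈ τ ∧ r = B.st (B.blk r)) := by simp [uu]

theorem st_mem_vv {σ τ i} : B.st i ∈ B.vv σ τ ↔ i ∈ σ := by
  simp [mem_vv, B.blk_st]

theorem st_mem_uu {τ i} : B.st i ∈ B.uu τ ↔ i ∈ τ := by
  simp [mem_uu, B.blk_st]

theorem st_inj : Function.Injective B.st := fun i j h => by
  rw [← B.blk_st i, h, B.blk_st]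

theorem uu_eq (τ) : B.uu τ = τ.image B.st := by
  ext r
  simp only [mem_uu, Finset.mem_image]
  constructor
  · rintro ⟨h, h'⟩; exact ⟨_, h, h'.symm⟩
  · rintro ⟨i, h, rfl⟩; simp [B.blk_st, h]

theorem full_vv {σ τ} : B.full (B.vv σ τ) = σ := by
  ext i
  rw [mem_full]
  constructor
  · intro h
    have := h (B.st i) (B.blk_st i)
    rwa [st_mem_vv] at this
  · rintro h r rfl
    exact B.mem_vv.2 (Or.inl h)

theorem disj_vu {σ τ} (h : Disjoint σ τ) : Disjoint (B.vv σ τ) (B.uu τ) := by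
  rw [Finset.disjoint_left] at *
  intro r hr hr'
  rw [mem_vv] at hr
  rw [mem_uu] at hr'
  rcases hr with h1 | h1
  · exact h h1 hr'.1
  · exact h1.2 hr'.2

theorem sum_blk (ω : Finset (Fin m)) (g : Fin m → ℕ) :
    ∑ r ∈ Finset.univ.filter (fun r => B.blk r ∈ ω), g (B.blk r) = ∑ i ∈ ω, J i * g i := by
  rw [← Finset.sum_fiberwise_of_maps_to (t := ω) (g := B.blk) (by simp)]
  refine Finset.sum_congr rfl fun i hi => ?_
  rw [Finset.sum_congr rfl (g := fun _ => g i)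
    (by intro r hr; rw [(Finset.mem_filter.1 hr).2]), Finset.sum_const, smul_eq_mul, ← B.card i]
  congr 2
  ext r
  simp only [Finset.mem_filter, Finset.mem_univ, true_and]
  constructor
  · exact fun h => h.2
  · rintro rfl; exact ⟨hi, rfl⟩

theorem one_le (B : BD m N J) (i) : 1 ≤ J i := by
  rw [← B.card i]
  exact Finset.card_pos.2 ⟨B.st i, by simp [B.blk_st]⟩

theorem sum_vv {σ τ} (hd : Disjoint σ τ) (g : Fin m → ℕ) :
    ∑ r ∈ B.vv σ τ, g (B.blk r) = ∑ i ∈ σ, J i * g i + ∑ i ∈ τ, (J i - 1) * g i := by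
  have h1 : ∑ r ∈ B.vv σ τ, g (B.blk r) + ∑ r ∈ B.uu τ, g (B.blk r) =
      ∑ r ∈ Finset.univ.filter (fun r => B.blk r ∈ σ ∪ τ), g (B.blk r) := by
    rw [← Finset.sum_union (B.disj_vu hd)]
    congr 1
    ext r
    simp only [Finset.mem_union, mem_vv, mem_uu, Finset.mem_filter, Finset.mem_univ, true_and]
    tauto
  rw [sum_blk, Finset.sum_union hd, uu_eq,
    Finset.sum_image (fun _ _ _ _ h => B.st_inj h)] at h1
  simp only [B.blk_st] at h1
  have h2 : ∑ i ∈ τ, J i * g i = ∑ i ∈ τ, (J i - 1) * g i + ∑ i ∈ τ, g i := by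
    rw [← Finset.sum_add_distrib]
    refine Finset.sum_congr rfl fun i _ => ?_
    have := B.one_le i
    obtain ⟨c, hc⟩ : ∃ c, J i = c + 1 := ⟨J i - 1, by omega⟩
    rw [hc]; simp; ring
  omega

theorem lt_st {r i} : r < B.st i ↔ B.blk r < i := by
  constructor
  · intro h
    by_contra h'
    rcases (not_lt.1 h').lt_or_eq with h2 | h2
    · exact lt_asymm h (B.mono _ _ (by rwa [B.blk_st]))
    · subst h2
      exact absurd (B.st_le r) (not_le.2 h)
  · intro h
    exact B.mono _ _ (by rwa [B.blk_st])

/-- goodness of block `i` -/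
def good (i : Fin m) (V U : Finset (Fin N)) : Prop :=
  (∃ r ∈ V ∪ U, B.blk r = i) → (B.st i ∈ V ∪ U ∧ ∀ r, B.blk r = i → r ≠ B.st i → r ∈ V)

open Classical in
/-- pivot -/
noncomputable def piv (i : Fin m) (S : Finset (Fin N)) : Fin N :=
  if B.st i ∈ S then B.st i else
    if h : ∃ r ∈ S, B.blk r = i then h.choose else B.st i

theorem piv_spec {i S} (h : ∃ r ∈ S, B.blk r = i) : B.piv i S ∈ S ∧ B.blk (B.piv i S) = i := by
  unfold piv
  split_ifs with h1
  · exact ⟨h1, B.blk_st i⟩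
  · exact h.choose_spec

theorem piv_st {i S} (h : B.st i ∈ S) : B.piv i S = B.st i := by
  unfold piv; rw [if_pos h]

theorem good_ins {i V U} (r) (hr : r ∈ U) (h : B.good i V U) :
    B.good i (insert r V) (U.erase r) := by
  have e : insert r V ∪ U.erase r = V ∪ U := by
    ext x; simp only [Finset.mem_union, Finset.mem_insert, Finset.mem_erase]
    by_cases hx : x = r
    · subst hx; simp [hr]
    · simp [hx]
  unfold good at *
  rw [e]
  intro h1
  refine ⟨(h h1).1, fun x h2 h3 => Finset.mem_insert_of_mem ((h h1).2 x h2 h3)⟩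

theorem un_ins {V U : Finset (Fin N)} {r} (hr : r ∈ U) : insert r V ∪ U.erase r = V ∪ U := by
  ext x; simp only [Finset.mem_union, Finset.mem_insert, Finset.mem_erase]
  by_cases hx : x = r
  · subst hx; simp [hr]
  · simp [hx]

theorem un_er {V U : Finset (Fin N)} {r} (hr : r ∈ V) : V.erase r ∪ insert r U = V ∪ U := by
  ext x; simp only [Finset.mem_union, Finset.mem_insert, Finset.mem_erase]
  by_cases hx : x = r
  · subst hx; simp [hr]
  · simp [hx]

theorem disj_er {V U : Finset (Fin N)} (hd : Disjoint V U) (r) :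
    Disjoint (V.erase r) (insert r U) := by
  rw [Finset.disjoint_left] at *
  intro x hx hx'
  rw [Finset.mem_erase] at hx
  rcases Finset.mem_insert.1 hx' with h | h
  · exact hx.1 h
  · exact hd hx.2 h

/-- removing the pivot of block `i` does not change goodness -/
theorem good_er {i j V U} (hp : B.piv i (V ∪ U) ∈ V) (hb : B.blk (B.piv i (V ∪ U)) = i) :
    B.good j (V.erase (B.piv i (V ∪ U))) (insert (B.piv i (V ∪ U)) U) ↔ B.good j V U := by
  unfold good
  rw [un_er hp]
  refine imp_congr_right fun h1 => and_congr_right fun h2 => ?_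
  refine forall_congr' fun r => ?_
  refine imp_congr_right fun h3 => imp_congr_right fun h4 => ?_
  rw [Finset.mem_erase]
  refine ⟨fun h => h.2, fun h => ⟨?_, h⟩⟩
  rintro h5
  by_cases hij : i = j
  · subst hij
    rw [B.piv_st h2] at h5
    exact h4 h5
  · rw [h5] at h3
    exact hij (hb.symm.trans h3)

/-- if block `i` is bad, removing a vertex in it does not change fullness -/
theorem full_er {i V U} (hbad : ¬ B.good i V U) (p) (hp : B.blk p = i) :
    B.full (V.erase p) = B.full V := by
  ext j
  rw [mem_full, mem_full]
  constructor
  · exact fun h r hr => Finset.mem_of_mem_erase (h r hr)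
  · intro h r hr
    refine Finset.mem_erase.2 ⟨?_, h r hr⟩
    rintro rfl
    apply hbad
    rw [← hp, hr]
    intro _
    exact ⟨Finset.mem_union_left _ (h _ (B.blk_st _)), fun s hs _ => h s hs⟩

end BD

namespace BD

variable {m N : ℕ} {J : Fin m → ℕ} (B : BD m N J)

open Classical in
/-- the partial homotopy contracting block `i` -/
noncomputable def hOp (F : Set (Finset (Fin N))) (i : Fin m) : RMod F →ₗ[ℤ] RMod F :=
  Finsupp.lift (RMod F) ℤ (MonIdx F) fun b =>
    if ¬ B.good i b.1.1 b.1.2 ∧ B.piv i (b.1.1 ∪ b.1.2) ∈ b.1.1 then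
      sg b.1.1 (B.piv i (b.1.1 ∪ b.1.2)) •
        mon F (b.1.1.erase (B.piv i (b.1.1 ∪ b.1.2))) (insert (B.piv i (b.1.1 ∪ b.1.2)) b.1.2)
    else 0

theorem bad_ex {i V U} (h : ¬ B.good i V U) : ∃ r ∈ V ∪ U, B.blk r = i := by
  by_contra h'
  exact h (fun h2 => absurd h2 h')

open Classical in
theorem hOp_mon {F : Set (Finset (Fin N))} {K : Set (Finset (Fin m))}
    (hFK : ∀ V, V ∈ F ↔ B.full V ∈ K) (i : Fin m) {V U : Finset (Fin N)} (hd : Disjoint V U) :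
    B.hOp F i (mon F V U) =
    if ¬ B.good i V U ∧ B.piv i (V ∪ U) ∈ V then
      sg V (B.piv i (V ∪ U)) • mon F (V.erase (B.piv i (V ∪ U))) (insert (B.piv i (V ∪ U)) U)
    else 0 := by
  by_cases h : V ∈ F
  · unfold hOp
    rw [lift_mon _ h hd]
  · rw [mon_not h, map_zero]
    split_ifs with h1
    · rw [mon_not, smul_zero]
      rw [hFK, B.full_er h1.1 _ (B.piv_spec (B.bad_ex h1.1)).2, ← hFK]
      exact h
    · rfl

/-- the projection -/
noncomputable def PP (F : Set (Finset (Fin N))) (i : Fin m) : RMod F →ₗ[ℤ] RMod F :=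
  LinearMap.id - ((dR F (fun _ => 1)).comp (B.hOp F i) + (B.hOp F i).comp (dR F (fun _ => 1)))

theorem PP_apply (F : Set (Finset (Fin N))) (i : Fin m) (x) :
    B.PP F i x = x - (dR F (fun _ => 1) (B.hOp F i x) + B.hOp F i (dR F (fun _ => 1) x)) := rfl

theorem PP_good {F : Set (Finset (Fin N))} (hF : DownC F) {K : Set (Finset (Fin m))}
    (hFK : ∀ V, V ∈ F ↔ B.full V ∈ K) (i : Fin m) {V U : Finset (Fin N)} (hd : Disjoint V U)
    (hg : B.good i V U) : B.PP F i (mon F V U) = mon F V U := by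
  rw [PP_apply, B.hOp_mon hFK i hd, if_neg (fun h => h.1 hg), dR1_mon hF hd, map_sum,
    Finset.sum_eq_zero]
  · simp
  · intro r hr
    rw [map_smul, B.hOp_mon hFK i (disj_ins hd r), if_neg (fun h => h.1 (B.good_ins r hr hg)),
      smul_zero]

theorem PP_mem {F : Set (Finset (Fin N))} (hF : DownC F) {K : Set (Finset (Fin m))}
    (hFK : ∀ V, V ∈ F ↔ B.full V ∈ K) (i : Fin m) {V U : Finset (Fin N)} (hd : Disjoint V U)
    (G : Submodule ℤ (RMod F))
    (hG : ∀ V' U', Disjoint V' U' → B.good i V' U' →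
      (∀ j, B.good j V U → B.good j V' U') → mon F V' U' ∈ G) :
    B.PP F i (mon F V U) ∈ G := by
  by_cases hg : B.good i V U
  · rw [B.PP_good hF hFK i hd hg]
    exact hG V U hd hg (fun _ h => h)
  obtain ⟨hpS, hpb⟩ := B.piv_spec (B.bad_ex hg)
  obtain ⟨p, hp⟩ : ∃ p, p = B.piv i (V ∪ U) := ⟨_, rfl⟩
  rw [← hp] at hpS hpb
  have hpr : ∀ r ∈ U, B.piv i (insert r V ∪ U.erase r) = p := by
    intro r hr; rw [un_ins hr, hp]
  rw [PP_apply, B.hOp_mon hFK i hd, dR1_mon hF hd, map_sum]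
  by_cases hpV : p ∈ V
  · have hpU : p ∉ U := Finset.disjoint_left.1 hd hpV
    obtain ⟨W, hW⟩ : ∃ W, W = V.erase p := ⟨_, rfl⟩
    have hVW : V = insert p W := by rw [hW, Finset.insert_erase hpV]
    have hpW : p ∉ W := by rw [hW]; simp
    rw [← hp, if_pos ⟨hg, hpV⟩, map_smul, dR1_mon hF (disj_er hd p), Finset.sum_insert hpU,
      Finset.erase_insert hpU, Finset.insert_erase hpV, smul_add, smul_smul]
    have e1 : sg V p * sg (V.erase p) p = 1 := by
      rw [← hW, hVW, sg_insert hpW, if_neg (lt_irrefl _), one_mul, sg_sq]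
    rw [e1, one_smul, Finset.smul_sum, add_assoc, ← Finset.sum_add_distrib, sub_add_cancel_left]
    refine G.neg_mem (G.sum_mem fun r hr => ?_)
    have hrp : r ≠ p := fun h => hpU (h ▸ hr)
    have hrV : r ∉ V := fun h => Finset.disjoint_left.1 hd h hr
    have hrW : r ∉ W := fun h => hrV (hVW ▸ Finset.mem_insert_of_mem h)
    have e2 : insert r (V.erase p) = (insert r V).erase p :=
      (Finset.erase_insert_of_ne hrp).symm
    have e3 : (insert p U).erase r = insert p (U.erase r) :=
      Finset.erase_insert_of_ne hrp.symm
    rw [e2, e3, map_smul, B.hOp_mon hFK i (disj_ins hd r), hpr r hr]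
    have hge : ∀ j, B.good j ((insert r V).erase p) (insert p (U.erase r)) ↔
        B.good j (insert r V) (U.erase r) := by
      intro j
      have := B.good_er (i := i) (j := j) (V := insert r V) (U := U.erase r)
      rw [hpr r hr] at this
      exact this (Finset.mem_insert_of_mem hpV) hpb
    by_cases hg2 : B.good i (insert r V) (U.erase r)
    · rw [if_neg (fun h => h.1 hg2), smul_zero, add_zero]
      refine G.smul_mem _ (G.smul_mem _ (hG _ _ (disj_er (disj_ins hd r) p) ((hge i).2 hg2) ?_))
      intro j hj
      exact (hge j).2 (B.good_ins r hr hj)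
    · rw [if_pos ⟨hg2, Finset.mem_insert_of_mem hpV⟩, smul_smul, smul_smul, ← add_smul]
      have e4 : sg V p * sg (V.erase p) r + sg V r * sg (insert r V) p = 0 := by
        rw [sg_insert hrV, ← hW, hVW, sg_insert hpW, sg_insert hpW]
        rcases lt_or_gt_of_ne hrp with h | h
        · rw [if_pos h, if_neg (not_lt.2 h.le), if_neg (lt_irrefl _)]; ring
        · rw [if_pos h, if_neg (not_lt.2 h.le), if_neg (lt_irrefl _)]; ring
      rw [e4, zero_smul]
      exact G.zero_mem
  · have hpU : p ∈ U := (Finset.mem_union.1 hpS).resolve_left hpV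
    rw [← hp, if_neg (fun h => hpV h.2), map_zero, zero_add, Finset.sum_eq_single p]
    · have hb : ¬ B.good i (insert p V) (U.erase p) := by
        have := B.good_er (i := i) (j := i) (V := insert p V) (U := U.erase p)
        rw [hpr p hpU, Finset.erase_insert hpV, Finset.insert_erase hpU] at this
        rw [← this (Finset.mem_insert_self _ _) hpb]
        exact hg
      rw [map_smul, B.hOp_mon hFK i (disj_ins hd p), hpr p hpU,
        if_pos ⟨hb, Finset.mem_insert_self _ _⟩, Finset.erase_insert hpV,
        Finset.insert_erase hpU, smul_smul, sg_insert hpV, if_neg (lt_irrefl _), one_mul, sg_sq,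
        one_smul, sub_self]
      exact G.zero_mem
    · intro r hr hrp
      rw [map_smul, B.hOp_mon hFK i (disj_ins hd r), hpr r hr, if_neg, smul_zero]
      rintro ⟨_, h⟩
      rcases Finset.mem_insert.1 h with h | h
      · exact hrp h.symm
      · exact hpV h
    · exact fun h => absurd hpU h

/-- span of monomials good at all blocks in `A` -/
noncomputable def GG (F : Set (Finset (Fin N))) (A : Finset (Fin m)) : Submodule ℤ (RMod F) :=
  Submodule.span ℤ {x | ∃ V U, Disjoint V U ∧ (∀ i ∈ A, B.good i V U) ∧ x = mon F V U}

theorem retract {F : Set (Finset (Fin N))} (hF : DownC F) {K : Set (Finset (Fin m))}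
    (hFK : ∀ V, V ∈ F ↔ B.full V ∈ K) (A : Finset (Fin m)) :
    ∃ P H : RMod F →ₗ[ℤ] RMod F,
      (∀ x, P x = x - (dR F (fun _ => 1) (H x) + H (dR F (fun _ => 1) x))) ∧
      (∀ x, P x ∈ B.GG F A) ∧ (∀ x ∈ B.GG F Finset.univ, P x = x) := by
  induction A using Finset.induction_on with
  | empty =>
    refine ⟨LinearMap.id, 0, by simp, ?_, fun _ _ => rfl⟩
    intro x
    suffices h : B.GG F ∅ = ⊤ by rw [h]; trivial
    rw [eq_top_iff]
    intro y _
    induction y using Finsupp.induction_linear with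
    | zero => exact Submodule.zero_mem _
    | add f g hf hg => exact Submodule.add_mem _ (hf trivial) (hg trivial)
    | single b c =>
      have : (Finsupp.single b c : RMod F) = c • mon F b.1.1 b.1.2 := by
        rw [mon_of]; simp
      rw [this]
      refine Submodule.smul_mem _ _ (Submodule.subset_span ⟨_, _, b.2.2, by simp, rfl⟩)
  | insert i A hi ih =>
    obtain ⟨P, H, h1, h2, h3⟩ := ih
    have hPd : ∀ x, P (dR F (fun _ => 1) x) = dR F (fun _ => 1) (P x) := by
      intro x
      rw [h1, h1, map_sub, map_add, dd hF, dd hF]; simp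
    refine ⟨(B.PP F i).comp P, H + (B.hOp F i).comp P, ?_, ?_, ?_⟩
    · intro x
      simp only [LinearMap.comp_apply, LinearMap.add_apply, map_add]
      rw [PP_apply, hPd]
      nth_rewrite 1 [h1]
      abel
    · intro x
      have : B.GG F A ≤ (B.GG F (insert i A)).comap (B.PP F i) := by
        refine Submodule.span_le.2 ?_
        rintro _ ⟨V, U, hd, hg, rfl⟩
        change B.PP F i (mon F V U) ∈ B.GG F (insert i A)
        refine B.PP_mem hF hFK i hd _ ?_
        intro V' U' hd' hg' hj
        refine Submodule.subset_span ⟨V', U', hd', ?_, rfl⟩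
        intro j hjA
        rcases Finset.mem_insert.1 hjA with h | h
        · rw [h]; exact hg'
        · exact hj j (hg j h)
      exact this (h2 x)
    · intro x hx
      rw [LinearMap.comp_apply, h3 x hx]
      have : B.GG F Finset.univ ≤ LinearMap.eqLocus (B.PP F i) LinearMap.id := by
        refine Submodule.span_le.2 ?_
        rintro _ ⟨V, U, hd, hg, rfl⟩
        exact B.PP_good hF hFK i hd (hg i (Finset.mem_univ _))
      exact this hx

end BD

namespace BD

variable {m N : ℕ} {J : Fin m → ℕ} (B : BD m N J)

theorem sum_vv' {σ τ} (hd : Disjoint σ τ) (g : Fin m → ℕ) :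
    ∑ r ∈ B.vv σ τ, g (B.blk r) = ∑ i ∈ σ ∪ τ, (if i ∈ σ then J i else J i - 1) * g i := by
  rw [B.sum_vv hd, Finset.sum_union hd]
  congr 1
  · exact Finset.sum_congr rfl fun i hi => by rw [if_pos hi]
  · exact Finset.sum_congr rfl fun i hi => by
      rw [if_neg (fun h => Finset.disjoint_left.1 hd h hi)]

theorem J_one {i} : J i = 1 ↔ ∀ r, B.blk r = i → r = B.st i := by
  rw [← B.card i, Finset.card_eq_one]
  constructor
  · rintro ⟨a, ha⟩ r hr
    have h1 : r ∈ ({a} : Finset (Fin N)) := by rw [← ha]; simp [hr]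
    have h2 : B.st i ∈ ({a} : Finset (Fin N)) := by rw [← ha]; simp [B.blk_st]
    rw [Finset.mem_singleton] at h1 h2
    rw [h1, h2]
  · intro h
    refine ⟨B.st i, ?_⟩
    ext r
    simp only [Finset.mem_filter, Finset.mem_univ, true_and, Finset.mem_singleton]
    exact ⟨h r, fun h => by rw [h, B.blk_st]⟩

theorem cond_iff {σ τ σ' τ' : Finset (Fin m)} :
    (Disjoint (B.vv σ τ) (B.vv σ' τ') ∧ Disjoint (B.uu τ) (B.vv σ' τ')) ↔
    (Disjoint σ σ' ∧ Disjoint τ σ' ∧ ∀ i ∈ (σ ∩ τ') ∪ (τ ∩ τ'), J i = 1) := by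
  simp only [Finset.disjoint_left]
  constructor
  · rintro ⟨h1, h2⟩
    refine ⟨fun i hi hi' => h1 (B.st_mem_vv.2 hi) (B.st_mem_vv.2 hi'),
      fun i hi hi' => h2 (B.st_mem_uu.2 hi) (B.st_mem_vv.2 hi'), ?_⟩
    intro i hi
    rw [B.J_one]
    rintro r rfl
    by_contra hr
    simp only [Finset.mem_union, Finset.mem_inter] at hi
    refine h1 (a := r) ?_ ?_ <;> rw [mem_vv] <;> tauto
  · rintro ⟨h1, h2, h3⟩
    have h3' : ∀ r, (B.blk r ∈ σ ∨ B.blk r ∈ τ) → B.blk r ∈ τ' → r = B.st (B.blk r) := by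
      intro r hr hr'
      refine B.J_one.1 (h3 (B.blk r) ?_) r rfl
      simp only [Finset.mem_union, Finset.mem_inter]
      tauto
    constructor
    · intro r hr hr'
      rw [mem_vv] at hr hr'
      have a1 := @h1 (B.blk r)
      have a2 := @h2 (B.blk r)
      have a3 := h3' r
      tauto
    · intro r hr hr'
      rw [mem_vv] at hr'
      rw [mem_uu] at hr
      have a2 := @h2 (B.blk r)
      tauto

theorem vv_union (σ τ σ' τ' : Finset (Fin m)) :
    B.vv (σ ∪ σ') ((τ ∪ τ') \ (σ ∪ σ')) = B.vv σ τ ∪ B.vv σ' τ' := by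
  ext r
  simp only [Finset.mem_union, mem_vv, Finset.mem_sdiff]
  tauto

theorem uu_union (σ τ σ' τ' : Finset (Fin m)) :
    B.uu ((τ ∪ τ') \ (σ ∪ σ')) = (B.uu τ ∪ B.uu τ') \ (B.vv σ τ ∪ B.vv σ' τ') := by
  ext r
  simp only [Finset.mem_union, mem_vv, mem_uu, Finset.mem_sdiff]
  tauto

theorem vv_ins {σ τ : Finset (Fin m)} {i} (hi : i ∈ τ) :
    B.vv (insert i σ) (τ.erase i) = insert (B.st i) (B.vv σ τ) := by
  ext r
  simp only [mem_vv, Finset.mem_insert, Finset.mem_erase]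
  by_cases h : B.blk r = i
  · subst h; simp [hi]; tauto
  · have : r ≠ B.st i := fun h' => h (by rw [h', B.blk_st])
    simp [h, this]

theorem uu_er {τ : Finset (Fin m)} {i} :
    B.uu (τ.erase i) = (B.uu τ).erase (B.st i) := by
  rw [uu_eq, uu_eq, Finset.image_erase B.st_inj]

theorem sign_d {σ τ : Finset (Fin m)} (hd : Disjoint σ τ) (i) :
    sg (B.vv σ τ) (B.st i) = (-1 : ℤ) ^ (∑ k ∈ σ.filter (fun k => k < i), J k +
            ∑ k ∈ τ.filter (fun k => k < i), (J k - 1)) := by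
  unfold sg
  congr 1
  rw [Finset.card_filter]
  simp only [lt_st]
  rw [B.sum_vv hd (fun k => if k < i then 1 else 0)]
  simp [Finset.sum_filter]

theorem sign_mul {σ τ σ' τ' : Finset (Fin m)} (hd : Disjoint σ τ) (hd' : Disjoint σ' τ')
    (hc : Disjoint (B.vv σ τ) (B.vv σ' τ')) :
    (∑ r ∈ B.vv σ τ ∪ B.uu τ, ∑ s ∈ (B.vv σ' τ' ∪ B.uu τ').filter (fun s => s < r),
        (if r ∈ B.vv σ τ then 1 else 1 - 1) * (if s ∈ B.vv σ' τ' then 1 else 1 - 1)) =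
    ∑ i ∈ σ ∪ τ, ∑ k ∈ (σ' ∪ τ').filter (fun k => k < i),
        (if i ∈ σ then J i else J i - 1) * (if k ∈ σ' then J k else J k - 1) := by
  have e1 : ∀ i, ∑ k ∈ (σ' ∪ τ').filter (fun k => k < i),
        (if i ∈ σ then J i else J i - 1) * (if k ∈ σ' then J k else J k - 1) =
      (if i ∈ σ then J i else J i - 1) * ∑ s ∈ B.vv σ' τ', if B.blk s < i then 1 else 0 := by
    intro i
    rw [B.sum_vv' hd' (fun k => if k < i then 1 else 0), ← Finset.mul_sum, Finset.sum_filter]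
    simp only [mul_ite, mul_one, mul_zero]
  simp only [e1]
  rw [← B.sum_vv' hd (fun i => ∑ s ∈ B.vv σ' τ', if B.blk s < i then 1 else 0)]
  symm
  refine Finset.sum_subset_zero_on_sdiff Finset.subset_union_left ?_ ?_
  · intro r hr
    rw [Finset.mem_sdiff] at hr
    simp [hr.2]
  · intro r hr
    rw [Finset.sum_filter]
    refine Finset.sum_subset_zero_on_sdiff Finset.subset_union_left ?_ ?_
    · intro s hs
      rw [Finset.mem_sdiff] at hs
      simp [hs.2]
    · intro s hs
      have : s < r ↔ B.blk s < B.blk r := by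
        refine ⟨fun h => ?_, B.mono s r⟩
        by_contra h'
        rcases (not_lt.1 h').lt_or_eq with h2 | h2
        · exact lt_asymm h (B.mono _ _ h2)
        · refine Finset.disjoint_left.1 hc hr ?_
          rw [mem_vv] at hs ⊢
          have h3 : r ≠ B.st (B.blk r) := by
            intro h4
            have := B.st_le s
            rw [← h2, ← h4] at this
            exact absurd this (not_le.2 h)
          rw [← h2] at hs
          tauto
      simp [hr, hs, this]

/-- the map on basis elements -/
def idx {F : Set (Finset (Fin N))} {K : Set (Finset (Fin m))}
    (hFK : ∀ V, V ∈ F ↔ B.full V ∈ K) (b : MonIdx K) : MonIdx F :=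
  ⟨(B.vv b.1.1 b.1.2, B.uu b.1.2), (hFK _).2 (by rw [full_vv]; exact b.2.1), B.disj_vu b.2.2⟩

theorem idx_inj {F : Set (Finset (Fin N))} {K : Set (Finset (Fin m))}
    (hFK : ∀ V, V ∈ F ↔ B.full V ∈ K) : Function.Injective (B.idx hFK) := by
  intro a b h
  have h1 : B.vv a.1.1 a.1.2 = B.vv b.1.1 b.1.2 := congrArg (fun x => x.1.1) h
  have h2 : B.uu a.1.2 = B.uu b.1.2 := congrArg (fun x => x.1.2) h
  apply Subtype.ext
  apply Prod.ext
  · rw [← B.full_vv (σ := a.1.1) (τ := a.1.2), h1, full_vv]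
  · ext i
    rw [← B.st_mem_uu, h2, B.st_mem_uu]

/-- the dga map -/
noncomputable def phi {F : Set (Finset (Fin N))} {K : Set (Finset (Fin m))}
    (hFK : ∀ V, V ∈ F ↔ B.full V ∈ K) : RMod K →ₗ[ℤ] RMod F :=
  Finsupp.lmapDomain ℤ ℤ (B.idx hFK)

theorem phi_mon {F : Set (Finset (Fin N))} {K : Set (Finset (Fin m))}
    (hFK : ∀ V, V ∈ F ↔ B.full V ∈ K) {σ τ : Finset (Fin m)} (hd : Disjoint σ τ) :
    B.phi hFK (mon K σ τ) = mon F (B.vv σ τ) (B.uu τ) := by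
  by_cases h : σ ∈ K
  · have h1 : ∀ b : MonIdx K, B.phi hFK (mon K b.1.1 b.1.2) =
        mon F (B.vv b.1.1 b.1.2) (B.uu b.1.2) := by
      intro b
      rw [mon_of]
      refine (Finsupp.mapDomain_single).trans ?_
      exact (mon_of (B.idx hFK b)).symm
    exact h1 ⟨(σ, τ), h, hd⟩
  · rw [mon_not h, map_zero, mon_not]
    rw [hFK, full_vv]; exact h

theorem phi_d {F : Set (Finset (Fin N))} {K : Set (Finset (Fin m))}
    (hFK : ∀ V, V ∈ F ↔ B.full V ∈ K) (hF : DownC F) (hK : DownC K) (x) :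
    B.phi hFK (dR K J x) = dR F (fun _ => 1) (B.phi hFK x) := by
  suffices h : (B.phi hFK).comp (dR K J) = (dR F (fun _ => 1)).comp (B.phi hFK) from
    LinearMap.congr_fun h x
  apply lin_ext
  intro σ τ hσ hd
  rw [LinearMap.comp_apply, LinearMap.comp_apply, dR_mon hK J hd, B.phi_mon hFK hd,
    dR1_mon hF (B.disj_vu hd), map_sum]
  conv_rhs => rw [uu_eq, Finset.sum_image (fun _ _ _ _ h => B.st_inj h), ← uu_eq]
  refine Finset.sum_congr rfl fun i hi => ?_
  rw [map_smul, B.phi_mon hFK (disj_ins hd i), B.sign_d hd, B.vv_ins hi, uu_er]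

theorem phi_mul {F : Set (Finset (Fin N))} {K : Set (Finset (Fin m))}
    (hFK : ∀ V, V ∈ F ↔ B.full V ∈ K) (hF : DownC F) (hK : DownC K) (x y) :
    B.phi hFK (mulR K J x y) = mulR F (fun _ => 1) (B.phi hFK x) (B.phi hFK y) := by
  suffices h : (mulR K J).compr₂ (B.phi hFK) =
      (mulR F (fun _ => 1)).compl₁₂ (B.phi hFK) (B.phi hFK) from
    LinearMap.congr_fun (LinearMap.congr_fun h x) y
  apply lin_ext
  intro σ τ hσ hd
  apply lin_ext
  intro σ' τ' hσ' hd'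
  rw [LinearMap.compr₂_apply, LinearMap.compl₁₂_apply, mulR_mon hK J hd hd',
    B.phi_mon hFK hd, B.phi_mon hFK hd', mulR_mon hF _ (B.disj_vu hd) (B.disj_vu hd')]
  by_cases hc : Disjoint (B.vv σ τ) (B.vv σ' τ') ∧ Disjoint (B.uu τ) (B.vv σ' τ')
  · rw [if_pos (B.cond_iff.1 hc), if_pos ⟨hc.1, hc.2, fun _ _ => rfl⟩, map_smul,
      B.phi_mon hFK Finset.disjoint_sdiff, B.sign_mul hd hd' hc.1, vv_union, uu_union]
  · rw [if_neg (fun h => hc (B.cond_iff.2 h)), if_neg (fun h => hc ⟨h.1, h.2.1⟩), map_zero]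

theorem phi_one {F : Set (Finset (Fin N))} {K : Set (Finset (Fin m))}
    (hFK : ∀ V, V ∈ F ↔ B.full V ∈ K) : B.phi hFK (oneR K) = oneR F := by
  rw [oneR_eq, oneR_eq, B.phi_mon hFK (by simp)]
  congr 1 <;> ext r <;> simp [mem_vv, mem_uu]

theorem phi_deg {F : Set (Finset (Fin N))} {K : Set (Finset (Fin m))}
    (hFK : ∀ V, V ∈ F ↔ B.full V ∈ K) (p : ℕ) (x)
    (hx : x ∈ partSub (degMon (F := K) J) p) :
    B.phi hFK x ∈ partSub (degMon (F := F) fun _ => 1) p := by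
  classical
  intro b hb
  obtain ⟨a, ha, rfl⟩ := Finset.mem_image.1 (Finsupp.mapDomain_support hb)
  rw [← hx a ha]
  have := B.sum_vv a.2.2 (fun _ => 1)
  unfold degMon
  simp only [mul_one] at this
  rw [← this]
  simp [idx]

theorem phi_inj {F : Set (Finset (Fin N))} {K : Set (Finset (Fin m))}
    (hFK : ∀ V, V ∈ F ↔ B.full V ∈ K) : Function.Injective (B.phi hFK) :=
  Finsupp.mapDomain_injective (B.idx_inj hFK)

theorem GG_range {F : Set (Finset (Fin N))} {K : Set (Finset (Fin m))}
    (hFK : ∀ V, V ∈ F ↔ B.full V ∈ K) :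
    B.GG F Finset.univ = LinearMap.range (B.phi hFK) := by
  apply le_antisymm
  · refine Submodule.span_le.2 ?_
    rintro _ ⟨V, U, hd, hg, rfl⟩
    have hU : ∀ r ∈ U, r = B.st (B.blk r) := by
      intro r hr
      by_contra h
      have := (hg (B.blk r) (Finset.mem_univ _) ⟨r, Finset.mem_union_right _ hr, rfl⟩).2 r rfl h
      exact Finset.disjoint_left.1 hd this hr
    have hd' : Disjoint (B.full V) (Finset.univ.filter fun i => B.st i ∈ U) := by
      rw [Finset.disjoint_left]
      intro i hi hi'
      rw [mem_full] at hi
      exact Finset.disjoint_left.1 hd (hi _ (B.blk_st i)) (Finset.mem_filter.1 hi').2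
    refine ⟨mon K (B.full V) (Finset.univ.filter fun i => B.st i ∈ U), ?_⟩
    rw [B.phi_mon hFK hd']
    congr 1
    · ext r
      rw [mem_vv, mem_full, Finset.mem_filter]
      constructor
      · rintro (h | ⟨⟨_, h⟩, h'⟩)
        · exact h r rfl
        · exact (hg (B.blk r) (Finset.mem_univ _)
            ⟨_, Finset.mem_union_right _ h, B.blk_st _⟩).2 r rfl h'
      · intro h
        have hh := hg (B.blk r) (Finset.mem_univ _) ⟨r, Finset.mem_union_left _ h, rfl⟩
        rcases Finset.mem_union.1 hh.1 with h1 | h1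
        · left
          intro s hs
          by_cases h2 : s = B.st (B.blk r)
          · rw [h2]; exact h1
          · exact hh.2 s hs h2
        · right
          refine ⟨⟨Finset.mem_univ _, h1⟩, fun h3 => ?_⟩
          rw [← h3] at h1
          exact Finset.disjoint_left.1 hd h h1
    · ext r
      rw [mem_uu, Finset.mem_filter]
      constructor
      · rintro ⟨⟨_, h⟩, h'⟩
        rw [h']; exact h
      · intro h
        rw [← hU r h]
        exact ⟨⟨Finset.mem_univ _, h⟩, rfl⟩
  · rintro _ ⟨x, rfl⟩
    induction x using Finsupp.induction_linear with
    | zero => rw [map_zero]; exact Submodule.zero_mem _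
    | add f g hf hg => rw [map_add]; exact Submodule.add_mem _ hf hg
    | single b c =>
      have : (Finsupp.single b c : RMod K) = c • mon K b.1.1 b.1.2 := by
        rw [mon_of]; simp
      rw [this, map_smul, B.phi_mon hFK b.2.2]
      refine Submodule.smul_mem _ _ (Submodule.subset_span ⟨_, _, B.disj_vu b.2.2, ?_, rfl⟩)
      rintro i - ⟨r, hr, rfl⟩
      have hi : B.blk r ∈ b.1.1 ∨ B.blk r ∈ b.1.2 := by
        rw [Finset.mem_union, mem_vv, mem_uu] at hr
        tauto
      constructor
      · rw [Finset.mem_union, st_mem_vv, st_mem_uu]; exact hi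
      · intro s hs hs'
        rw [mem_vv, hs]
        tauto

end BD

theorem sum_Iic_eq {m : ℕ} (J : Fin m → ℕ) (i : Fin m) :
    ∑ k ∈ Finset.Iic i, J k = startJ J i + J i := by
  unfold startJ
  rw [← Finset.Iio_insert, Finset.sum_insert (by simp), add_comm]

theorem start_le {m : ℕ} (J : Fin m → ℕ) {i k : Fin m} (h : i < k) :
    startJ J i + J i ≤ startJ J k := by
  rw [← sum_Iic_eq]
  refine Finset.sum_le_sum_of_subset fun x hx => ?_
  rw [Finset.mem_Iio]
  exact lt_of_le_of_lt (Finset.mem_Iic.1 hx) h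

theorem start_le_dJ {m : ℕ} (J : Fin m → ℕ) (i : Fin m) :
    startJ J i + J i ≤ dJ J := by
  rw [← sum_Iic_eq]
  exact Finset.sum_le_sum_of_subset (Finset.subset_univ _)

theorem exists_blk {m : ℕ} (J : Fin m → ℕ) (r : Fin (dJ J)) :
    ∃ i, startJ J i ≤ (r : ℕ) ∧ (r : ℕ) < startJ J i + J i := by
  by_contra hcon
  push Not at hcon
  have h1 : ∀ i : Fin m, startJ J i + J i ≤ (r : ℕ) := by
    intro i
    induction i using WellFoundedLT.induction with
    | ind i ih =>
      refine hcon i ?_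
      rcases Nat.eq_zero_or_pos i.1 with h0 | h0
      · have : Finset.Iio i = ∅ := by
          ext x
          simp only [Finset.mem_Iio, Finset.notMem_empty, iff_false, not_lt]
          exact Fin.le_def.2 (by omega)
        unfold startJ
        rw [this]; simp
      · have hlt : (⟨i.1 - 1, by omega⟩ : Fin m) < i := Fin.lt_def.2 (by simp; omega)
        refine le_trans (le_of_eq ?_) (ih _ hlt)
        rw [← sum_Iic_eq]
        unfold startJ
        congr 1
        ext x
        simp only [Finset.mem_Iio, Finset.mem_Iic, Fin.lt_def, Fin.le_def]
        omega
  have h2 : dJ J ≤ (r : ℕ) := by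
    rcases Nat.eq_zero_or_pos m with h0 | h0
    · subst h0; simp [dJ]
    · have := h1 ⟨m - 1, by omega⟩
      rw [← sum_Iic_eq] at this
      refine le_trans (le_of_eq ?_) this
      unfold dJ
      congr 1
      ext x
      simp only [Finset.mem_univ, Finset.mem_Iic, Fin.le_def, true_iff]
      omega
  exact absurd r.2 (not_lt.2 h2)

theorem mem_Bblk {m : ℕ} (J : Fin m → ℕ) (i : Fin m) (r : Fin (dJ J)) :
    r ∈ Bblk J i ↔ startJ J i ≤ (r : ℕ) ∧ (r : ℕ) < startJ J i + J i := by
  unfold Bblk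
  rw [sum_Iic_eq, Finset.mem_filter]
  exact ⟨fun h => h.2, fun h => ⟨Finset.mem_univ _, h⟩⟩

theorem blk_unique {m : ℕ} (J : Fin m → ℕ) {i k : Fin m} {r : ℕ}
    (h : startJ J i ≤ r ∧ r < startJ J i + J i)
    (h' : startJ J k ≤ r ∧ r < startJ J k + J k) : i = k := by
  rcases lt_trichotomy i k with h1 | h1 | h1
  · have := start_le J h1; omega
  · exact h1
  · have := start_le J h1; omega

theorem choose_eq {m : ℕ} (J : Fin m → ℕ) (r : Fin (dJ J)) (i : Fin m) :
    (exists_blk J r).choose = i ↔ startJ J i ≤ (r : ℕ) ∧ (r : ℕ) < startJ J i + J i := by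
  have h := (exists_blk J r).choose_spec
  constructor
  · intro h'; rw [h'] at h; exact h
  · exact fun hh => blk_unique J h hh

/-- the block data of `J` -/
noncomputable def theBD {m : ℕ} (J : Fin m → ℕ) (hJ : ∀ i, 1 ≤ J i) : BD m (dJ J) J where
  blk r := (exists_blk J r).choose
  st i := ⟨startJ J i, by have := start_le_dJ J i; have := hJ i; omega⟩
  blk_st i := by
    rw [choose_eq]
    have := hJ i
    simp only
    omega
  mono r s h := by
    have h1 := (exists_blk J r).choose_spec
    have h2 := (exists_blk J s).choose_spec
    have h3 := start_le J h
    rw [Fin.lt_def]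
    omega
  st_le r := (exists_blk J r).choose_spec.1
  card i := by
    simp only [choose_eq]
    have h0 := start_le_dJ J i
    rw [← Finset.card_map Fin.valEmbedding]
    have : Finset.map Fin.valEmbedding (Finset.univ.filter (fun r : Fin (dJ J) =>
        startJ J i ≤ (r : ℕ) ∧ (r : ℕ) < startJ J i + J i)) =
        Finset.Ico (startJ J i) (startJ J i + J i) := by
      ext x
      simp only [Finset.mem_map, Finset.mem_filter, Finset.mem_univ, true_and,
        Fin.valEmbedding_apply, Finset.mem_Ico]
      constructor
      · rintro ⟨a, ha, rfl⟩; exact ha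
      · intro h; exact ⟨⟨x, by omega⟩, h, rfl⟩
    rw [this]
    simp

theorem exists_missing {m : ℕ} (K : ASC m) (ω : Finset (Fin m)) (h : ω ∉ K.faces) :
    ∃ τ ⊆ ω, IsMissingFace K τ := by
  induction ω using Finset.strongInduction with
  | H ω ih =>
    by_cases h1 : ∀ s ⊂ ω, s ∈ K.faces
    · exact ⟨ω, subset_rfl, h, h1⟩
    · push Not at h1
      obtain ⟨s, hs, hs'⟩ := h1
      obtain ⟨τ, hτ, h2⟩ := ih s hs hs'
      exact ⟨τ, hτ.trans hs.1, h2⟩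

theorem mem_Bblk' {m : ℕ} (J : Fin m → ℕ) (hJ : ∀ i, 1 ≤ J i) (i : Fin m) (r : Fin (dJ J)) :
    r ∈ Bblk J i ↔ (theBD J hJ).blk r = i := by
  rw [mem_Bblk]
  exact (choose_eq J r i).symm

theorem mem_KJ {m : ℕ} (K : ASC m) (J : Fin m → ℕ) (hJ : ∀ i, 1 ≤ J i)
    (V : Finset (Fin (dJ J))) : V ∈ KJfaces K J ↔ (theBD J hJ).full V ∈ K.faces := by
  have key : ∀ τ : Finset (Fin m), τ.biUnion (Bblk J) ⊆ V ↔ τ ⊆ (theBD J hJ).full V := by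
    intro τ
    rw [Finset.biUnion_subset]
    refine forall_congr' fun i => imp_congr_right fun _ => ?_
    rw [BD.mem_full]
    refine forall_congr' fun r => ?_
    rw [mem_Bblk' J hJ]
  constructor
  · intro h
    by_contra h'
    obtain ⟨τ, h1, h2⟩ := exists_missing K _ h'
    exact h τ h2 ((key τ).2 h1)
  · intro h τ hτ h1
    exact hτ.1 (K.down_closed h ((key τ).1 h1))

theorem KJ_down {m : ℕ} (K : ASC m) (J : Fin m → ℕ) : DownC (KJfaces K J) :=
  fun _ _ h h' τ hτ h1 => h τ hτ (h1.trans h')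

theorem prodV_eq {m : ℕ} (K : ASC m) (J : Fin m → ℕ) (s : Finset (Fin (dJ J))) :
    prodV K J s = mon (KJfaces K J) s ∅ := by
  have key : ∀ l : List (Fin (dJ J)), l.Pairwise (· < ·) →
      (l.map (genV (KJfaces K J))).foldr
        (fun a b => mulR (KJfaces K J) (fun _ => 1) a b) (oneR (KJfaces K J)) =
      mon (KJfaces K J) l.toFinset ∅ := by
    intro l
    induction l with
    | nil => intro _; simp [oneR_eq]
    | cons a l ih =>
      intro h
      rw [List.pairwise_cons] at h
      rw [List.map_cons, List.foldr_cons, ih h.2, genV_eq,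
        mulR_mon (KJ_down K J) _ (by simp) (by simp), if_pos]
      · have h0 : (l.toFinset ∪ ∅).filter (fun k => k < a) = ∅ := by
          ext x
          simp only [Finset.union_empty, Finset.mem_filter, List.mem_toFinset,
            Finset.notMem_empty, iff_false, not_and, not_lt]
          exact fun hx => (h.1 x hx).le
        rw [Finset.union_empty, Finset.sum_singleton, h0, Finset.sum_empty, pow_zero, one_smul]
        simp
      · refine ⟨?_, by simp, by simp⟩
        simp only [Finset.disjoint_singleton_left, List.mem_toFinset]
        exact fun h' => lt_irrefl _ (h.1 a h')
  unfold prodV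
  rw [key _ (Finset.sortedLT_sort s).pairwise, Finset.sort_toFinset]

theorem mem_Btil {m : ℕ} (J : Fin m → ℕ) (hJ : ∀ i, 1 ≤ J i) (k : Fin m) (r : Fin (dJ J)) :
    r ∈ Btil J k ↔ (theBD J hJ).blk r = k ∧ r ≠ (theBD J hJ).st k := by
  unfold Btil
  rw [Finset.mem_filter, mem_Bblk' J hJ]
  refine and_congr_right fun h => ?_
  have h1 : startJ J k ≤ (r : ℕ) := by subst h; exact (theBD J hJ).st_le r
  rw [lt_iff_le_and_ne, ne_comm]
  constructor
  · rintro ⟨_, h2⟩ h3; exact h2 (by rw [h3]; rfl)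
  · intro h2
    exact ⟨h1, fun h3 => h2 (Fin.ext h3)⟩

theorem vImg_eq {m : ℕ} (K : ASC m) (J : Fin m → ℕ) (hJ : ∀ i, 1 ≤ J i) (k : Fin m) :
    vImg K J k = mon (KJfaces K J) ((theBD J hJ).vv {k} ∅) ((theBD J hJ).uu ∅) := by
  have hlt : startJ J k < dJ J := ((theBD J hJ).st k).2
  have hst : (⟨startJ J k, hlt⟩ : Fin (dJ J)) = (theBD J hJ).st k := rfl
  unfold vImg uKtil
  rw [dif_pos hlt, prodV_eq, hst, genV_eq, mulR_mon (KJ_down K J) _ (by simp) (by simp), if_pos]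
  · have h0 : (Btil J k ∪ ∅).filter (fun x => x < (theBD J hJ).st k) = ∅ := by
      ext x
      simp only [Finset.union_empty, Finset.mem_filter, mem_Btil J hJ,
        Finset.notMem_empty, iff_false, not_and, not_lt, and_imp]
      rintro rfl _
      exact (theBD J hJ).st_le x
    rw [Finset.union_empty, Finset.sum_singleton, h0, Finset.sum_empty, pow_zero, one_smul]
    congr 1
    · ext x
      simp only [Finset.mem_union, Finset.mem_singleton, mem_Btil J hJ, BD.mem_vv,
        Finset.notMem_empty, false_and, or_false]
      constructor
      · rintro (rfl | h)
        · exact (theBD J hJ).blk_st k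
        · exact h.1
      · intro h
        by_cases h' : x = (theBD J hJ).st k
        · exact Or.inl h'
        · exact Or.inr ⟨h, h'⟩
    · ext x; simp [BD.mem_uu]
  · refine ⟨?_, by simp, by simp⟩
    simp [mem_Btil J hJ]

theorem uImg_eq {m : ℕ} (K : ASC m) (J : Fin m → ℕ) (hJ : ∀ i, 1 ≤ J i) (k : Fin m) :
    uImg K J k = mon (KJfaces K J) ((theBD J hJ).vv ∅ {k}) ((theBD J hJ).uu {k}) := by
  have hlt : startJ J k < dJ J := ((theBD J hJ).st k).2
  have hst : (⟨startJ J k, hlt⟩ : Fin (dJ J)) = (theBD J hJ).st k := rfl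
  unfold uImg tKtil
  have h1 : (theBD J hJ).st k ∉ Btil J k := by simp [mem_Btil J hJ]
  rw [dif_pos hlt, prodV_eq, hst, genU_eq, mulR_mon (KJ_down K J) _ (by simp) (by simp), if_pos]
  · simp only [Finset.notMem_empty, if_false, Nat.sub_self, zero_mul, Finset.sum_const_zero,
      pow_zero, one_smul]
    congr 1
    · ext x
      simp only [Finset.mem_union, Finset.mem_singleton, mem_Btil J hJ, BD.mem_vv,
        Finset.notMem_empty, false_or]
      refine and_congr_right fun h => ?_
      rw [h]
    · ext x
      simp only [Finset.mem_sdiff, Finset.mem_union, Finset.mem_singleton, mem_Btil J hJ,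
        BD.mem_uu, Finset.notMem_empty, false_or, or_false]
      constructor
      · rintro ⟨rfl, _⟩
        simp [BD.blk_st]
      · rintro ⟨rfl, h⟩
        exact ⟨h, fun h' => h'.2 h⟩
  · refine ⟨by simp, ?_, by simp⟩
    rw [Finset.disjoint_singleton_left]; exact h1

/-- the assignment `ṽ^k ↦ u^{k̃}·∏_{r∈B̃_k} u^r`,
`ũ^k ↦ t^{k̃}·∏_{r∈B̃_k} u^r` extends to an injective homomorphism of differential
graded algebras `R*_K(J) → R*_{K(J)}` inducing an isomorphism on cohomology. -/
theorem stmt9 (hJ : ∀ i, 1 ≤ J i) :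
    ∃ φ : RMod K.faces →ₗ[ℤ] RMod (KJfaces K J),
      -- values on the generators
      (∀ k, φ (genV K.faces k) = vImg K J k) ∧
      (∀ k, φ (genU K.faces k) = uImg K J k) ∧
      -- homomorphism of algebras
      (∀ x y, φ (mulR K.faces J x y) = mulR (KJfaces K J) (fun _ => 1) (φ x) (φ y)) ∧
      φ (oneR K.faces) = oneR (KJfaces K J) ∧
      -- degree-preserving and commuting with the differentials
      (∀ (p : ℕ) (x), x ∈ partSub (degMon J) p → φ x ∈ partSub (degMon fun _ => 1) p) ∧
      (∀ x, φ (dR K.faces J x) = dR (KJfaces K J) (fun _ => 1) (φ x)) ∧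
      -- injective
      Function.Injective φ ∧
      -- quasi-isomorphism: induces an isomorphism on cohomology
      (∀ x, dR K.faces J x = 0 →
        (∃ z, φ x = dR (KJfaces K J) (fun _ => 1) z) → ∃ w, x = dR K.faces J w) ∧
      (∀ y, dR (KJfaces K J) (fun _ => 1) y = 0 →
        ∃ x, dR K.faces J x = 0 ∧ ∃ z, y - φ x = dR (KJfaces K J) (fun _ => 1) z) := by
  have hFK := mem_KJ K J hJ
  have hF := KJ_down K J
  have hK : DownC K.faces := fun _ _ h h' => K.down_closed h h'
  obtain ⟨P, H, h1, h2, h3⟩ := (theBD J hJ).retract hF hFK Finset.univ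
  rw [(theBD J hJ).GG_range hFK] at h2 h3
  have hPd : ∀ x, P (dR (KJfaces K J) (fun _ => 1) x) = dR (KJfaces K J) (fun _ => 1) (P x) := by
    intro x
    rw [h1, h1, map_sub, map_add, dd hF, dd hF]; simp
  refine ⟨(theBD J hJ).phi hFK, ?_, ?_, (theBD J hJ).phi_mul hFK hF hK, (theBD J hJ).phi_one hFK,
    (theBD J hJ).phi_deg hFK, (theBD J hJ).phi_d hFK hF hK, (theBD J hJ).phi_inj hFK, ?_, ?_⟩
  · intro k
    rw [genV_eq, (theBD J hJ).phi_mon hFK (by simp), vImg_eq K J hJ]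
  · intro k
    rw [genU_eq, (theBD J hJ).phi_mon hFK (by simp), uImg_eq K J hJ]
  · rintro x _ ⟨z, hz⟩
    obtain ⟨w, hw⟩ := h2 z
    refine ⟨w, (theBD J hJ).phi_inj hFK ?_⟩
    rw [(theBD J hJ).phi_d hFK hF hK, hw, ← hPd, ← hz, h3 _ ⟨x, rfl⟩]
  · intro y hy
    obtain ⟨x, hx⟩ := h2 y
    refine ⟨x, (theBD J hJ).phi_inj hFK ?_, H y, ?_⟩
    · rw [(theBD J hJ).phi_d hFK hF hK, hx, ← hPd, hy, map_zero, map_zero]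
    · rw [hx, h1, hy, map_zero]; simp

end
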